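/- Let A be a finite-dimensional algebra over a field, V a finitely generated projective right A-module, and B = End_A(V). If the restriction of the Schur functor F = Hom_A(Hom_{A^op}(V, A), −) : A-mod → B-mod to add(DA ⊕ A) is faithful, then V is a progenerator of mod-A and F is an equivalence of categories. -/

import Mathlib

open Function


section SchurFramework

variable {A : Type} [Ring A] {P : Type} [AddCommGroup P] [Module A P]

/-- `B = End_A(P)ᵒᵖ`. -/
abbrev Bop (A : Type) [Ring A] (P : Type) [AddCommGroup P] [Module A P] : Type :=
  (Module.End A P)ᵐᵒᵖ

/-- `F M = Hom_A(P, M)` is a left `B`-module via precomposition. -/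
instance instSMulBop (M : Type) [AddCommGroup M] [Module A M] :
    SMul (Bop A P) (P →ₗ[A] M) :=
  ⟨fun b φ => φ.comp b.unop⟩

@[simp] lemma smulBop_apply {M : Type} [AddCommGroup M] [Module A M]
    (b : Bop A P) (φ : P →ₗ[A] M) (p : P) : (b • φ) p = φ (b.unop p) := rfl

instance instModuleBop (M : Type) [AddCommGroup M] [Module A M] :
    Module (Bop A P) (P →ₗ[A] M) where
  one_smul φ := LinearMap.ext fun p => rfl
  mul_smul b c φ := LinearMap.ext fun p => rfl
  smul_zero b := rfl
  smul_add b φ ψ := rfl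
  add_smul b c φ := LinearMap.ext fun p => by
    simp only [smulBop_apply, MulOpposite.unop_add, LinearMap.add_apply, map_add]
  zero_smul φ := LinearMap.ext fun p => by
    simp only [smulBop_apply, MulOpposite.unop_zero, LinearMap.zero_apply, map_zero,
      LinearMap.zero_apply]

/-- Right multiplication by `a` on `F A = Hom_A(P, A)`, as a `B`-linear endomorphism.
This gives `F A` its right `A`-module structure. -/
def rmulA (a : A) : (P →ₗ[A] A) →ₗ[Bop A P] (P →ₗ[A] A) where
  toFun f :=
    { toFun := fun p => f p * a
      map_add' := fun p q => by simp [add_mul]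
      map_smul' := fun c p => by simp [smul_eq_mul, mul_assoc] }
  map_add' f g := LinearMap.ext fun p => by simp [add_mul]
  map_smul' b f := LinearMap.ext fun p => rfl

@[simp] lemma rmulA_apply (a : A) (f : P →ₗ[A] A) (p : P) : rmulA a f p = f p * a := rfl

lemma rmulA_one : (rmulA (A := A) (P := P) 1) = LinearMap.id :=
  LinearMap.ext fun f => LinearMap.ext fun p => by simp

lemma rmulA_mul (a b : A) :
    (rmulA (A := A) (P := P) (a * b)) = (rmulA b).comp (rmulA a) :=
  LinearMap.ext fun f => LinearMap.ext fun p => by simp [mul_assoc]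

lemma rmulA_add (a b : A) :
    (rmulA (A := A) (P := P) (a + b)) = rmulA a + rmulA b :=
  LinearMap.ext fun f => LinearMap.ext fun p => by simp [mul_add]

lemma rmulA_zero : (rmulA (A := A) (P := P) 0) = 0 :=
  LinearMap.ext fun f => LinearMap.ext fun p => by simp

/-- `G N = Hom_B(FA, N)` is a left `A`-module, via the right `A`-module structure of `FA`. -/
instance instSMulGA (N : Type) [AddCommGroup N] [Module (Bop A P) N] :
    SMul A ((P →ₗ[A] A) →ₗ[Bop A P] N) :=
  ⟨fun a g => g.comp (rmulA a)⟩

@[simp] lemma smulGA_apply {N : Type} [AddCommGroup N] [Module (Bop A P) N]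
    (a : A) (g : (P →ₗ[A] A) →ₗ[Bop A P] N) (f : P →ₗ[A] A) :
    (a • g) f = g (rmulA a f) := rfl

instance instModuleGA (N : Type) [AddCommGroup N] [Module (Bop A P) N] :
    Module A ((P →ₗ[A] A) →ₗ[Bop A P] N) where
  one_smul g := show g.comp (rmulA 1) = g by rw [rmulA_one, LinearMap.comp_id]
  mul_smul a b g := show g.comp (rmulA (a * b)) = (g.comp (rmulA b)).comp (rmulA a) by
    rw [rmulA_mul, LinearMap.comp_assoc]
  smul_zero a := LinearMap.zero_comp _
  smul_add a g h := LinearMap.add_comp _ _ _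
  add_smul a b g := show g.comp (rmulA (a + b)) = g.comp (rmulA a) + g.comp (rmulA b) by
    rw [rmulA_add, LinearMap.comp_add]
  zero_smul g := show g.comp (rmulA 0) = 0 by rw [rmulA_zero, LinearMap.comp_zero]

/-- For `f ∈ Hom_A(P, A)` and `x ∈ X`, the map `p ↦ f p • x`, an element of `F X`. -/
def starMap {X : Type} [AddCommGroup X] [Module A X] (f : P →ₗ[A] A) (x : X) :
    P →ₗ[A] X where
  toFun p := f p • x
  map_add' p q := by simp [add_smul]
  map_smul' a p := by simp [smul_eq_mul, mul_smul]

@[simp] lemma starMap_apply {X : Type} [AddCommGroup X] [Module A X]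
    (f : P →ₗ[A] A) (x : X) (p : P) : starMap f x p = f p • x := rfl

lemma starMap_addl {X : Type} [AddCommGroup X] [Module A X] (f g : P →ₗ[A] A) (x : X) :
    starMap (f + g) x = starMap f x + starMap g x :=
  LinearMap.ext fun p => by simp [add_smul]

lemma starMap_smulB {X : Type} [AddCommGroup X] [Module A X] (b : Bop A P)
    (f : P →ₗ[A] A) (x : X) : starMap (b • f) x = b • starMap f x :=
  LinearMap.ext fun p => rfl

lemma starMap_smulA {X : Type} [AddCommGroup X] [Module A X] (a : A)
    (f : P →ₗ[A] A) (x : X) : starMap f (a • x) = starMap (rmulA a f) x :=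
  LinearMap.ext fun p => by simp [mul_smul]

/-- The adjunction bijection `Φ : Hom_B(F X, M) → Hom_A(X, G M)` of `F ⊣ G`. -/
def PhiAdj {X : Type} [AddCommGroup X] [Module A X]
    {M : Type} [AddCommGroup M] [Module (Bop A P) M]
    (k : (P →ₗ[A] X) →ₗ[Bop A P] M) :
    X →ₗ[A] ((P →ₗ[A] A) →ₗ[Bop A P] M) where
  toFun x :=
    { toFun := fun f => k (starMap f x)
      map_add' := fun f g => by
        show k (starMap (f + g) x) = k (starMap f x) + k (starMap g x)
        rw [starMap_addl, map_add]
      map_smul' := fun b f => by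
        show k (starMap (b • f) x) = b • k (starMap f x)
        rw [starMap_smulB, map_smul] }
  map_add' x y := LinearMap.ext fun f => by
    have : starMap f (x + y) = starMap f x + starMap f y :=
      LinearMap.ext fun p => by simp [smul_add]
    simp [this]
  map_smul' a x := LinearMap.ext fun f => by
    simp [starMap_smulA]

/-- `G` on morphisms: post-composition. -/
def Gmap {M N : Type} [AddCommGroup M] [Module (Bop A P) M]
    [AddCommGroup N] [Module (Bop A P) N] (g : M →ₗ[Bop A P] N) :
    ((P →ₗ[A] A) →ₗ[Bop A P] M) →ₗ[A] ((P →ₗ[A] A) →ₗ[Bop A P] N) where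
  toFun φ := g.comp φ
  map_add' φ ψ := LinearMap.ext fun f => by simp
  map_smul' a φ := LinearMap.ext fun f => rfl


/-- `F` on morphisms: post-composition with `h`. -/
def Fmap {M N : Type} [AddCommGroup M] [Module A M] [AddCommGroup N] [Module A N]
    (h : M →ₗ[A] N) : (P →ₗ[A] M) →ₗ[Bop A P] (P →ₗ[A] N) where
  toFun φ := h.comp φ
  map_add' φ ψ := LinearMap.ext fun p => by simp
  map_smul' b φ := LinearMap.ext fun p => rfl

/-- The unit `η_X : X → G F X` of the adjunction `F ⊣ G`;
explicitly `η x f p = f p • x`. -/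
def etaL (X : Type) [AddCommGroup X] [Module A X] :
    X →ₗ[A] ((P →ₗ[A] A) →ₗ[Bop A P] (P →ₗ[A] X)) :=
  PhiAdj (LinearMap.id : (P →ₗ[A] X) →ₗ[Bop A P] (P →ₗ[A] X))

end SchurFramework

section DualAndSummands

variable (R : Type) [CommRing R] (A : Type) [Ring A] [Algebra R A]

/-- The dual `D A = Hom_R(A, R)` is a left `A`-module via `(a • f) x = f (x * a)`. -/
noncomputable instance dualModule : Module A (A →ₗ[R] R) where
  smul a f := f.comp (LinearMap.mulRight R a)
  one_smul f := LinearMap.ext fun x => by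
    show f ((LinearMap.mulRight R (1 : A)) x) = f x
    rw [LinearMap.mulRight_apply, mul_one]
  mul_smul a b f := LinearMap.ext fun x => by
    show f ((LinearMap.mulRight R (a * b)) x)
      = f ((LinearMap.mulRight R b) ((LinearMap.mulRight R a) x))
    simp only [LinearMap.mulRight_apply, mul_assoc]
  smul_zero a := rfl
  smul_add a f g := rfl
  add_smul a b f := LinearMap.ext fun x => by
    show f ((LinearMap.mulRight R (a + b)) x)
      = f ((LinearMap.mulRight R a) x) + f ((LinearMap.mulRight R b) x)
    simp only [LinearMap.mulRight_apply, mul_add, map_add]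
  zero_smul f := LinearMap.ext fun x => by
    show f ((LinearMap.mulRight R (0 : A)) x) = 0
    simp only [LinearMap.mulRight_apply, mul_zero, map_zero]

/-- `T` is a direct summand of `W` (as `A'`-modules). -/
def IsSummandOf (A' : Type) [Ring A'] (T W : Type) [AddCommGroup T] [Module A' T]
    [AddCommGroup W] [Module A' W] : Prop :=
  ∃ (i : T →ₗ[A'] W) (r : W →ₗ[A'] T), r.comp i = LinearMap.id

end DualAndSummands

section Progenerator

variable {A : Type} [Ring A] {P : Type} [AddCommGroup P] [Module A P]

lemma starMap_comp {X Y : Type} [AddCommGroup X] [Module A X] [AddCommGroup Y] [Module A Y]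
    (φ : X →ₗ[A] Y) (g : P →ₗ[A] A) (x : X) :
    starMap g (φ x) = φ.comp (starMap g x) :=
  LinearMap.ext fun p => by simp

lemma starMap_add_right {X : Type} [AddCommGroup X] [Module A X]
    (g : P →ₗ[A] A) (x y : X) : starMap g (x + y) = starMap g x + starMap g y :=
  LinearMap.ext fun p => by simp

lemma starMap_zero_right {X : Type} [AddCommGroup X] [Module A X]
    (g : P →ₗ[A] A) : starMap g (0 : X) = 0 :=
  LinearMap.ext fun p => by simp

/-- `F = Hom_A(P, -)` is faithful when `P` is a generator, witnessed by `∑ gⱼ pⱼ = 1`. -/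
lemma Fmap_injective_of_sum_eq_one {ι : Type} [Fintype ι] (g : ι → (P →ₗ[A] A)) (p : ι → P)
    (hgp : ∑ j, g j (p j) = 1) (M N : Type) [AddCommGroup M] [Module A M]
    [AddCommGroup N] [Module A N] :
    Function.Injective (fun h : M →ₗ[A] N => Fmap (A := A) (P := P) h) := by
  intro h₁ h₂ h
  ext m
  have key (j : ι) : h₁ (g j (p j) • m) = h₂ (g j (p j) • m) :=
    LinearMap.congr_fun (LinearMap.congr_fun h (starMap (g j) m)) (p j)
  rw [← one_smul A m, ← hgp, Finset.sum_smul, map_sum, map_sum]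
  exact Finset.sum_congr rfl fun j _ => key j

/-- `F = Hom_A(P, -)` is full when `P` is a generator, witnessed by `∑ gⱼ pⱼ = 1`. -/
lemma Fmap_surjective_of_sum_eq_one {ι : Type} [Fintype ι] (g : ι → (P →ₗ[A] A)) (p : ι → P)
    (hgp : ∑ j, g j (p j) = 1) (M N : Type) [AddCommGroup M] [Module A M]
    [AddCommGroup N] [Module A N] :
    Function.Surjective (fun h : M →ₗ[A] N => Fmap (A := A) (P := P) h) := by
  intro κ
  let h : M →+ N :=
    { toFun := fun m => ∑ j, κ (starMap (g j) m) (p j)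
      map_zero' := by simp [starMap_zero_right]
      map_add' := fun x y => by simp [starMap_add_right, Finset.sum_add_distrib] }
  have h_def (m : M) : h m = ∑ j, κ (starMap (g j) m) (p j) := rfl
  have h_apply (φ : P →ₗ[A] M) (x : P) : h (φ x) = κ φ x := by
    have hb (j : ι) : κ (starMap (g j) (φ x)) (p j) = κ φ (g j (p j) • x) := by
      have : starMap (g j) (φ x) =
          (MulOpposite.op (starMap (g j) x : Module.End A P) : Bop A P) • φ :=
        starMap_comp φ (g j) x
      rw [this, map_smul]
      rfl
    rw [h_def, Finset.sum_congr rfl fun j _ => hb j, ← map_sum, ← Finset.sum_smul, hgp, one_smul]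
  have h_smul (a : A) (m : M) : h (a • m) = a • h m := by
    have hm : a • m = ∑ j, starMap (g j) m (a • p j) := by
      simp only [starMap_apply, map_smul]
      rw [← Finset.smul_sum, ← Finset.sum_smul, hgp, one_smul]
    rw [hm, map_sum, h_def, Finset.smul_sum]
    exact Finset.sum_congr rfl fun j _ => by rw [h_apply, map_smul]
  refine ⟨{ toFun := h, map_add' := map_add h, map_smul' := h_smul }, ?_⟩
  exact LinearMap.ext fun φ => LinearMap.ext fun x => h_apply φ x

/-- A `B`-submodule `K` of `Hom_A(P, X)` contains every map whose values lie in the submodule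
of `X` generated by the values of the members of `K`, if `P` has a finite dual basis. -/
lemma mem_of_forall_apply_mem_span {ι : Type} [Fintype ι] (g : ι → (P →ₗ[A] A)) (p : ι → P)
    (hgp : ∀ x, ∑ i, g i x • p i = x) {X : Type} [AddCommGroup X] [Module A X]
    (K : Submodule (Bop A P) (P →ₗ[A] X)) (ψ : P →ₗ[A] X)
    (hψ : ∀ x, ψ x ∈ Submodule.span A {y | ∃ φ ∈ K, ∃ q, φ q = y}) : ψ ∈ K := by
  have hstar (y : X) (hy : y ∈ Submodule.span A {y | ∃ φ ∈ K, ∃ q, φ q = y}) :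
      ∀ f : P →ₗ[A] A, starMap f y ∈ K := by
    induction hy using Submodule.span_induction with
    | mem y hy =>
      obtain ⟨φ, hφ, q, rfl⟩ := hy
      intro f
      rw [starMap_comp]
      exact K.smul_mem (MulOpposite.op (starMap f q : Module.End A P)) hφ
    | zero => intro f; rw [starMap_zero_right]; exact K.zero_mem
    | add x y _ _ hx hy => intro f; rw [starMap_add_right]; exact K.add_mem (hx f) (hy f)
    | smul a x _ hx => intro f; rw [starMap_smulA]; exact hx _
  have hsum : ψ = ∑ i, starMap (g i) (ψ (p i)) := by
    ext x
    conv_lhs => rw [← hgp x]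
    simp
  rw [hsum]
  exact K.sum_mem fun i _ => hstar _ (hψ _) _

/-- The `B`-linear map `Hom_A(P, Pⁿ) → Q` sending the `i`-th coprojection to `q i`. -/
def homPiToModule {n : ℕ} {Q : Type*} [AddCommGroup Q] [Module (Bop A P) Q] (q : Fin n → Q) :
    (P →ₗ[A] (Fin n → P)) →ₗ[Bop A P] Q where
  toFun φ := ∑ i, (MulOpposite.op ((LinearMap.proj i).comp φ : Module.End A P) : Bop A P) • q i
  map_add' φ ψ := by
    simp only [LinearMap.comp_add, MulOpposite.op_add, add_smul, Finset.sum_add_distrib]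
  map_smul' b φ := by
    rw [RingHom.id_apply, Finset.smul_sum]
    refine Finset.sum_congr rfl fun i _ => ?_
    rw [← mul_smul]
    rfl

lemma homPiToModule_surjective {n : ℕ} {Q : Type*} [AddCommGroup Q] [Module (Bop A P) Q]
    (q : Fin n → Q) (hq : Submodule.span (Bop A P) (Set.range q) = ⊤) :
    Function.Surjective (homPiToModule (A := A) (P := P) q) := by
  intro y
  have hy : y ∈ Submodule.span (Bop A P) (Set.range q) := hq ▸ Submodule.mem_top
  obtain ⟨c, rfl⟩ := (Submodule.mem_span_range_iff_exists_fun _).1 hy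
  exact ⟨LinearMap.pi fun i => (c i).unop, rfl⟩

/-- Every finitely generated `B`-module is of the form `Hom_A(P, M)` with `M` finitely
generated, for `P` finitely generated projective. -/
lemma exists_finite_linearEquiv_hom [Module.Finite A P] [Module.Projective A P]
    {ι : Type} [Fintype ι] (g : ι → (P →ₗ[A] A)) (p : ι → P)
    (hgp : ∀ x, ∑ i, g i x • p i = x)
    (Q : Type*) [AddCommGroup Q] [Module (Bop A P) Q] [Module.Finite (Bop A P) Q] :
    ∃ M : ModuleCat.{0} A, Module.Finite A M ∧ Nonempty (Q ≃ₗ[Bop A P] (P →ₗ[A] M)) := by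
  obtain ⟨n, q, hq⟩ := Module.Finite.exists_fin (R := Bop A P) (M := Q)
  let π := homPiToModule (A := A) (P := P) q
  let K := LinearMap.ker π
  let K' : Submodule A (Fin n → P) := Submodule.span A {y | ∃ φ ∈ K, ∃ q, φ q = y}
  let ρ := Fmap (P := P) K'.mkQ
  have hρ : Function.Surjective ρ := fun ψ =>
    Module.projective_lifting_property K'.mkQ ψ K'.mkQ_surjective
  have hker : K = LinearMap.ker ρ := by
    ext φ
    constructor
    · intro hφ
      refine LinearMap.ext fun x => ?_
      exact (Submodule.Quotient.mk_eq_zero K').2 (Submodule.subset_span ⟨φ, hφ, x, rfl⟩)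
    · intro hφ
      refine mem_of_forall_apply_mem_span g p hgp K φ fun x => ?_
      exact (Submodule.Quotient.mk_eq_zero K').1 (LinearMap.congr_fun hφ x)
  refine ⟨ModuleCat.of A ((Fin n → P) ⧸ K'), inferInstanceAs (Module.Finite A (_ ⧸ K')), ⟨?_⟩⟩
  exact (π.quotKerEquivOfSurjective (homPiToModule_surjective q hq)).symm.trans
    ((Submodule.quotEquivOfEq _ _ hker).trans (ρ.quotKerEquivOfSurjective hρ))

end Progenerator

section RightModules

variable {A : Type} [Ring A] {V : Type} [AddCommGroup V] [Module Aᵐᵒᵖ V]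

/-- Evaluation at `v`, as a map of left modules `Hom_{Aᵒᵖ}(V, A) → A`. -/
def evalDual (v : V) : (V →ₗ[Aᵐᵒᵖ] A) →ₗ[A] A where
  toFun f := f v
  map_add' _ _ := rfl
  map_smul' _ _ := rfl

@[simp] lemma evalDual_apply (v : V) (f : V →ₗ[Aᵐᵒᵖ] A) : evalDual v f = f v := rfl

lemma exists_finite_dualBasis [Module.Finite Aᵐᵒᵖ V] [Module.Projective Aᵐᵒᵖ V] :
    ∃ (n : ℕ) (v : Fin n → V) (f : Fin n → (V →ₗ[Aᵐᵒᵖ] A)),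
      ∀ w, ∑ i, MulOpposite.op (f i w) • v i = w := by
  obtain ⟨n, v, hv⟩ := Module.Finite.exists_fin (R := Aᵐᵒᵖ) (M := V)
  have hsurj : Function.Surjective (Fintype.linearCombination Aᵐᵒᵖ v) := by
    rw [← LinearMap.range_eq_top, Fintype.range_linearCombination, hv]
  obtain ⟨s, hs⟩ := Module.projective_lifting_property _ (LinearMap.id : V →ₗ[Aᵐᵒᵖ] V) hsurj
  refine ⟨n, v, fun i =>
    { toFun := fun w => (s w i).unop
      map_add' := fun x y => by simp
      map_smul' := fun a x => by simp }, fun w => ?_⟩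
  simpa [Fintype.linearCombination_apply] using LinearMap.congr_fun hs w

lemma sum_evalDual_smul {n : ℕ} {v : Fin n → V} {f : Fin n → (V →ₗ[Aᵐᵒᵖ] A)}
    (hvf : ∀ w, ∑ i, MulOpposite.op (f i w) • v i = w) (φ : V →ₗ[Aᵐᵒᵖ] A) :
    ∑ i, evalDual (v i) φ • f i = φ := by
  ext w
  conv_rhs => rw [← hvf w]
  simp

variable (A V) in
/-- The trace of `V` in `A`, as a set of sums of values of maps `V → A`. -/
def traceAddSubgroup : AddSubgroup A :=
  AddSubgroup.closure {a | ∃ (f : V →ₗ[Aᵐᵒᵖ] A) (w : V), f w = a}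

lemma mul_mul_mem_trace (x a y : A) (ha : a ∈ traceAddSubgroup A V) :
    x * a * y ∈ traceAddSubgroup A V := by
  induction ha using AddSubgroup.closure_induction with
  | mem a ha =>
    obtain ⟨f, w, rfl⟩ := ha
    exact AddSubgroup.subset_closure ⟨x • f, MulOpposite.op y • w, by simp [mul_assoc]⟩
  | zero => simp
  | add a b _ _ ha hb => rw [mul_add, add_mul]; exact AddSubgroup.add_mem _ ha hb
  | neg a _ ha => rw [mul_neg, neg_mul]; exact AddSubgroup.neg_mem _ ha

lemma apply_mem_trace [Module.Finite Aᵐᵒᵖ V] [Module.Projective Aᵐᵒᵖ V]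
    (φ : (V →ₗ[Aᵐᵒᵖ] A) →ₗ[A] A) (f : V →ₗ[Aᵐᵒᵖ] A) : φ f ∈ traceAddSubgroup A V := by
  obtain ⟨n, v, g, hvg⟩ := exists_finite_dualBasis (A := A) (V := V)
  rw [← sum_evalDual_smul hvg f, map_sum]
  refine AddSubgroup.sum_mem _ fun i _ => ?_
  rw [map_smul, smul_eq_mul]
  simpa using mul_mul_mem_trace 1 _ (φ (g i))
    (AddSubgroup.subset_closure ⟨f, v i, rfl⟩ : f (v i) ∈ traceAddSubgroup A V)

lemma exists_sum_of_mem_trace {a : A} (ha : a ∈ traceAddSubgroup A V) :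
    ∃ (n : ℕ) (f : Fin n → (V →ₗ[Aᵐᵒᵖ] A)) (w : Fin n → V), ∑ j, f j (w j) = a := by
  induction ha using AddSubgroup.closure_induction with
  | mem a ha =>
    obtain ⟨f, w, rfl⟩ := ha
    exact ⟨1, fun _ => f, fun _ => w, by simp⟩
  | zero => exact ⟨0, Fin.elim0, Fin.elim0, by simp⟩
  | add a b _ _ ha hb =>
    obtain ⟨n, f, w, rfl⟩ := ha
    obtain ⟨m, g, u, rfl⟩ := hb
    exact ⟨n + m, Fin.append f g, Fin.append w u, by simp [Fin.sum_univ_add]⟩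
  | neg a _ ha =>
    obtain ⟨n, f, w, rfl⟩ := ha
    exact ⟨n, fun j => -f j, w, by simp⟩

end RightModules

lemma smul_dual_apply {k A : Type} [Field k] [Ring A] [Algebra k A]
    (ξ : A →ₗ[k] k) (a x : A) : (a • ξ) x = ξ (x * a) := rfl

/-- If `F` kills no nonzero map `A → DA`, then the trace of `V` in `A` is all of `A`. -/
lemma one_mem_trace (k : Type) [Field k] {A : Type} [Ring A] [Algebra k A]
    {V : Type} [AddCommGroup V] [Module Aᵐᵒᵖ V]
    [Module.Finite Aᵐᵒᵖ V] [Module.Projective Aᵐᵒᵖ V]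
    (h_inj : Function.Injective
      (fun h : A →ₗ[A] (A →ₗ[k] k) => Fmap (A := A) (P := V →ₗ[Aᵐᵒᵖ] A) h)) :
    (1 : A) ∈ traceAddSubgroup A V := by
  by_contra h_one
  let I : Submodule k A :=
    { (traceAddSubgroup A V).toAddSubmonoid with
      smul_mem' := fun c x hx => by
        have := mul_mul_mem_trace (V := V) (algebraMap k A c) x 1 hx
        rwa [mul_one, ← Algebra.smul_def] at this }
  obtain ⟨ξ, hξ, hξI⟩ := Submodule.exists_le_ker_of_notMem (p := I) h_one
  have h_zero : LinearMap.toSpanSingleton A (A →ₗ[k] k) ξ = 0 := by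
    apply h_inj
    refine LinearMap.ext fun φ => LinearMap.ext fun f => LinearMap.ext fun x => ?_
    have hx : x * φ f * 1 ∈ traceAddSubgroup A V := mul_mul_mem_trace x _ 1 (apply_mem_trace φ f)
    rw [mul_one] at hx
    exact hξI (show x * φ f ∈ I from hx)
  apply hξ
  have h_ev := LinearMap.congr_fun (LinearMap.congr_fun h_zero (1 : A)) (1 : A)
  rwa [LinearMap.toSpanSingleton_apply, smul_dual_apply, mul_one] at h_ev

/-- Let `A` be a finite-dimensional algebra over a field `k`, `V` a
finitely generated projective right `A`-module, `P = Hom_{Aᵒᵖ}(V, A)` and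
`B = End_A(P)ᵒᵖ ≅ End_A(V)`.  If the restriction of the Schur functor
`F = Hom_A(P, −)` to `add(DA ⊕ A)` is faithful, then `V` is a progenerator of `mod-A`
and `F : A`-mod `→ B`-mod is an equivalence of categories. -/
theorem faithful_on_addDAA_equivalence
    (k : Type) [Field k] (A : Type) [Ring A] [Algebra k A] [FiniteDimensional k A]
    (V : Type) [AddCommGroup V] [Module Aᵐᵒᵖ V]
    [Module.Finite Aᵐᵒᵖ V] [Module.Projective Aᵐᵒᵖ V]
    [Module.Finite A (V →ₗ[Aᵐᵒᵖ] A)] [Module.Projective A (V →ₗ[Aᵐᵒᵖ] A)]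
    (hfaithful : ∀ (M N : Type) [AddCommGroup M] [Module A M] [AddCommGroup N] [Module A N],
      (∃ n : ℕ, IsSummandOf A M (Fin n → ((A →ₗ[k] k) × A))) →
      (∃ n : ℕ, IsSummandOf A N (Fin n → ((A →ₗ[k] k) × A))) →
      Function.Injective
        (fun h : M →ₗ[A] N => Fmap (A := A) (P := V →ₗ[Aᵐᵒᵖ] A) h)) :
    (∃ n : ℕ, IsSummandOf Aᵐᵒᵖ A (Fin n → V)) ∧
    (∀ (M N : Type) [AddCommGroup M] [Module A M] [AddCommGroup N] [Module A N],
      Module.Finite A M → Module.Finite A N →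
        Function.Bijective
          (fun h : M →ₗ[A] N => Fmap (A := A) (P := V →ₗ[Aᵐᵒᵖ] A) h)) ∧
    (∀ Q : ModuleCat (Bop A (V →ₗ[Aᵐᵒᵖ] A)), Module.Finite (Bop A (V →ₗ[Aᵐᵒᵖ] A)) Q →
      ∃ M : ModuleCat A, Module.Finite A M ∧
        Nonempty (Q ≃ₗ[Bop A (V →ₗ[Aᵐᵒᵖ] A)] ((V →ₗ[Aᵐᵒᵖ] A) →ₗ[A] M))) := by
  have hDA : ∃ n : ℕ, IsSummandOf A (A →ₗ[k] k) (Fin n → ((A →ₗ[k] k) × A)) :=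
    ⟨1, LinearMap.pi fun _ => LinearMap.inl A _ _,
      (LinearMap.fst A _ _).comp (LinearMap.proj 0), LinearMap.ext fun _ => rfl⟩
  have hA : ∃ n : ℕ, IsSummandOf A A (Fin n → ((A →ₗ[k] k) × A)) :=
    ⟨1, LinearMap.pi fun _ => LinearMap.inr A _ _,
      (LinearMap.snd A _ _).comp (LinearMap.proj 0), LinearMap.ext fun _ => rfl⟩
  obtain ⟨n, f, w, hfw⟩ := exists_sum_of_mem_trace
    (one_mem_trace k (V := V) (hfaithful A (A →ₗ[k] k) hA hDA))
  have hgen : ∑ j, evalDual (w j) (f j) = 1 := hfw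
  obtain ⟨m, v, g, hvg⟩ := exists_finite_dualBasis (A := A) (V := V)
  refine ⟨⟨n, ?_⟩, fun M N _ _ _ _ _ _ => ⟨?_, ?_⟩, fun Q hQ => ?_⟩
  · refine ⟨
      { toFun := fun a j => MulOpposite.op a • w j
        map_add' := fun a b => by ext j; simp [add_smul]
        map_smul' := fun c a => by ext j; simp [mul_smul] },
      ∑ j, (f j).comp (LinearMap.proj j), LinearMap.ext fun a => ?_⟩
    simp [← Finset.sum_mul, hfw]
  · exact Fmap_injective_of_sum_eq_one _ f hgen M N
  · exact Fmap_surjective_of_sum_eq_one _ f hgen M N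
  · exact exists_finite_linearEquiv_hom _ g (sum_evalDual_smul hvg) Q
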